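/- Suppose 0 < R < 2 and R ≠ R_n. Then the set of configurations in M_n(R) having at least two stretched-out arms, namely {x = (C, J_1, …, J_n) ∈ M_n(R) : there exist j ≠ k with a_j = b_j and a_k = b_k}, is finite and has exactly n·2^{n−2} elements. -/

import Mathlib

/-- Euclidean norm of a vector in ℝ². -/
noncomputable def enorm2 (v : ℝ × ℝ) : ℝ := Real.sqrt (v.1 ^ 2 + v.2 ^ 2)

/-- The k-th fixed endpoint `B_k = (R cos(2kπ/n), R sin(2kπ/n))` (indices from 0). -/
noncomputable def Bpt (n : ℕ) (R : ℝ) (k : Fin n) : ℝ × ℝ :=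
  (R * Real.cos (2 * (k.val : ℝ) * Real.pi / (n : ℝ)),
   R * Real.sin (2 * (k.val : ℝ) * Real.pi / (n : ℝ)))

/-- The configuration space `M_n(R)` of spiders with `n` arms of radius `R`,
as a subset of `(ℝ²)^{n+1} ≅ ℝ^{2n+2}`: a pair `(C, J)` with
`|C − J_k| = 1` and `|J_k − B_k| = 1` for all `k`. -/
noncomputable def MSpace (n : ℕ) (R : ℝ) : Set ((ℝ × ℝ) × (Fin n → ℝ × ℝ)) :=
  {x | ∀ k : Fin n, enorm2 (x.1 - x.2 k) = 1 ∧ enorm2 (x.2 k - Bpt n R k) = 1}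

/-- `d_n`, the maximum distance between `n`-th roots of unity. -/
noncomputable def dmax (n : ℕ) : ℝ :=
  if Even n then 2
  else Real.sqrt (2 - 2 * Real.cos (2 * ((n / 2 : ℕ) : ℝ) * Real.pi / (n : ℝ)))

/-- The critical radius `R_n = 2 / d_n`. -/
noncomputable def Rcrit (n : ℕ) : ℝ := 2 / dmax n

lemma sp_enorm (v : ℝ × ℝ) : enorm2 v = 1 ↔ v.1 ^ 2 + v.2 ^ 2 = 1 := by
  unfold enorm2
  exact Real.sqrt_eq_one

/-- squared distance -/
noncomputable def spD (C B : ℝ × ℝ) : ℝ := (C.1 - B.1) ^ 2 + (C.2 - B.2) ^ 2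

/-- the two elbow positions -/
noncomputable def spJ (C B : ℝ × ℝ) (s : ℝ) : ℝ × ℝ :=
  ((C.1 + B.1) / 2 - s * (C.2 - B.2), (C.2 + B.2) / 2 + s * (C.1 - B.1))

open Classical in
noncomputable def spA (C B : ℝ × ℝ) : Finset (ℝ × ℝ) :=
  {spJ C B (√(1 / spD C B - 1 / 4)), spJ C B (-√(1 / spD C B - 1 / 4))}

lemma sp_le {C B J : ℝ × ℝ} (h1 : enorm2 (C - J) = 1) (h2 : enorm2 (J - B) = 1) :
    spD C B ≤ 4 := by
  rw [sp_enorm] at h1 h2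
  simp only [Prod.fst_sub, Prod.snd_sub] at h1 h2
  unfold spD
  nlinarith [sq_nonneg (C.1 - J.1 - (J.1 - B.1)), sq_nonneg (C.2 - J.2 - (J.2 - B.2))]

lemma sp_str {C B J : ℝ × ℝ} (h1 : enorm2 (C - J) = 1)
    (h : C - J = J - B) : spD C B = 4 := by
  rw [sp_enorm] at h1
  have e1 := congrArg Prod.fst h
  have e2 := congrArg Prod.snd h
  simp only [Prod.fst_sub, Prod.snd_sub] at h1 e1 e2
  unfold spD
  have : C.1 - B.1 = 2 * (C.1 - J.1) := by linarith
  have h' : C.2 - B.2 = 2 * (C.2 - J.2) := by linarith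
  rw [this, h']
  nlinarith

lemma sp_str' {C B J : ℝ × ℝ} (h1 : enorm2 (C - J) = 1) (h2 : enorm2 (J - B) = 1)
    (h : spD C B = 4) : C - J = J - B := by
  rw [sp_enorm] at h1 h2
  simp only [Prod.fst_sub, Prod.snd_sub] at h1 h2
  unfold spD at h
  have h0 : (C.1 - J.1 - (J.1 - B.1)) ^ 2 + (C.2 - J.2 - (J.2 - B.2)) ^ 2 = 0 := by
    nlinarith
  have e1 : C.1 - J.1 - (J.1 - B.1) = 0 := by
    apply pow_eq_zero_iff (two_ne_zero) |>.1
    nlinarith [sq_nonneg (C.1 - J.1 - (J.1 - B.1)), sq_nonneg (C.2 - J.2 - (J.2 - B.2))]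
  have e2 : C.2 - J.2 - (J.2 - B.2) = 0 := by
    apply pow_eq_zero_iff (two_ne_zero) |>.1
    nlinarith [sq_nonneg (C.1 - J.1 - (J.1 - B.1)), sq_nonneg (C.2 - J.2 - (J.2 - B.2))]
  ext
  · simp; linarith
  · simp; linarith

lemma sp_memA {C B J : ℝ × ℝ} (h0 : 0 < spD C B) (h4 : spD C B ≤ 4) :
    J ∈ spA C B ↔ (enorm2 (C - J) = 1 ∧ enorm2 (J - B) = 1) := by
  have hs : √(1 / spD C B - 1 / 4) ^ 2 = 1 / spD C B - 1 / 4 := by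
    apply Real.sq_sqrt
    have : 1 / 4 ≤ 1 / spD C B := one_div_le_one_div_of_le h0 h4
    linarith
  have key : ∀ s : ℝ, s ^ 2 = 1 / spD C B - 1 / 4 →
      enorm2 (C - spJ C B s) = 1 ∧ enorm2 (spJ C B s - B) = 1 := by
    intro s hs
    have h : s ^ 2 * spD C B = 1 - spD C B / 4 := by
      rw [hs]; field_simp
    rw [sp_enorm, sp_enorm]
    unfold spD at h
    simp only [spJ, Prod.fst_sub, Prod.snd_sub]
    constructor <;> linear_combination h
  simp only [spA, Finset.mem_insert, Finset.mem_singleton]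
  constructor
  · rintro (rfl | rfl)
    · exact key _ hs
    · exact key _ (by rw [neg_sq, hs])
  · rintro ⟨h1, h2⟩
    rw [sp_enorm] at h1 h2
    simp only [Prod.fst_sub, Prod.snd_sub] at h1 h2
    set q := spD C B with hq
    have hq' : q = (C.1 - B.1) ^ 2 + (C.2 - B.2) ^ 2 := hq
    set t := (-(J.1 - (C.1 + B.1) / 2) * (C.2 - B.2) + (J.2 - (C.2 + B.2) / 2) * (C.1 - B.1)) / q
      with ht
    have htq : t * q =
      (-(J.1 - (C.1 + B.1) / 2) * (C.2 - B.2) + (J.2 - (C.2 + B.2) / 2) * (C.1 - B.1)) := by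
      rw [ht]; field_simp
    have horth : (J.1 - (C.1 + B.1) / 2) * (C.1 - B.1) + (J.2 - (C.2 + B.2) / 2) * (C.2 - B.2)
        = 0 := by linear_combination (h2 - h1) / 2
    have hJ : J = spJ C B t := by
      ext
      · apply mul_right_cancel₀ h0.ne'
        simp only [spJ]
        linear_combination (C.2 - B.2) * htq + (C.1 - B.1) * horth +
          (J.1 - (C.1 + B.1) / 2) * hq'
      · apply mul_right_cancel₀ h0.ne'
        simp only [spJ]
        linear_combination -(C.1 - B.1) * htq + (C.2 - B.2) * horth +
          (J.2 - (C.2 + B.2) / 2) * hq'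
    have ht2 : t ^ 2 = √(1 / q - 1 / 4) ^ 2 := by
      rw [hs]
      have e1 := congrArg Prod.fst hJ
      have e2 := congrArg Prod.snd hJ
      simp only [spJ] at e1 e2
      have : t ^ 2 * q = 1 - q / 4 := by
        rw [e1, e2] at h1
        rw [hq']
        linear_combination h1
      field_simp
      linarith
    rcases sq_eq_sq_iff_eq_or_eq_neg.1 ht2 with h | h
    · left; rw [hJ, h]
    · right; rw [hJ, h]

lemma sp_cardA1 {C B : ℝ × ℝ} (h4 : spD C B = 4) : (spA C B).card = 1 := by
  simp [spA, h4]

lemma sp_cardA2 {C B : ℝ × ℝ} (h0 : 0 < spD C B) (h4 : spD C B < 4) : (spA C B).card = 2 := by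
  unfold spA
  apply Finset.card_pair
  intro h
  have hs : 0 < √(1 / spD C B - 1 / 4) := by
    apply Real.sqrt_pos.2
    have : 1 / 4 < 1 / spD C B := one_div_lt_one_div_of_lt h0 h4
    linarith
  set s := √(1 / spD C B - 1 / 4)
  have e1 := congrArg Prod.fst h
  have e2 := congrArg Prod.snd h
  simp only [spJ] at e1 e2
  have f1 : s * (C.2 - B.2) = 0 := by linarith
  have f2 : s * (C.1 - B.1) = 0 := by linarith
  rcases mul_eq_zero.1 f1 with f1 | f1
  · linarith
  rcases mul_eq_zero.1 f2 with f2 | f2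
  · linarith
  unfold spD at h0
  rw [f1, f2] at h0
  norm_num at h0

/-- vertex radius -/
noncomputable def spr (n : ℕ) (R : ℝ) : ℝ :=
  -(R * Real.cos (Real.pi / n)) + √((R * Real.cos (Real.pi / n)) ^ 2 + (4 - R ^ 2))

noncomputable def spQ (r φ : ℝ) : ℝ × ℝ := (-(r * Real.cos φ), -(r * Real.sin φ))

noncomputable def spP (n : ℕ) (R : ℝ) (m : Fin n) : ℝ × ℝ :=
  spQ (spr n R) ((2 * (m.val : ℝ) + 1) * Real.pi / n)

lemma sp_cos_nonneg (n : ℕ) (hn : 2 ≤ n) : 0 ≤ Real.cos (Real.pi / n) := by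
  have hn' : (2 : ℝ) ≤ n := by exact_mod_cast hn
  have hp := Real.pi_pos
  apply Real.cos_nonneg_of_neg_pi_div_two_le_of_le
  · have : 0 ≤ Real.pi / n := by positivity
    linarith
  · exact div_le_div_of_nonneg_left hp.le (by norm_num) hn'

lemma sp_r_pos (n : ℕ) (R : ℝ) (hR0 : 0 < R) (hR2 : R < 2) : 0 < spr n R := by
  unfold spr
  have h : R * Real.cos (Real.pi / n) < √((R * Real.cos (Real.pi / n)) ^ 2 + (4 - R ^ 2)) := by
    apply Real.lt_sqrt_of_sq_lt
    nlinarith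
  linarith

lemma sp_r_eq (n : ℕ) (R : ℝ) (hR0 : 0 < R) (hR2 : R < 2) :
    (spr n R) ^ 2 + R ^ 2 + 2 * spr n R * R * Real.cos (Real.pi / n) = 4 := by
  have h : √((R * Real.cos (Real.pi / n)) ^ 2 + (4 - R ^ 2)) ^ 2
      = (R * Real.cos (Real.pi / n)) ^ 2 + (4 - R ^ 2) := by
    apply Real.sq_sqrt
    nlinarith [sq_nonneg (R * Real.cos (Real.pi / n))]
  unfold spr
  linear_combination h

lemma sp_r_uniq (n : ℕ) (hn : 2 ≤ n) (R : ℝ) (hR0 : 0 < R) (hR2 : R < 2) (ρ : ℝ) (hρ : 0 < ρ)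
    (h : ρ ^ 2 + R ^ 2 + 2 * ρ * R * Real.cos (Real.pi / n) = 4) : ρ = spr n R := by
  have h1 := sp_r_eq n R hR0 hR2
  have h2 := sp_r_pos n R hR0 hR2
  have h3 := sp_cos_nonneg n hn
  have h4 : (ρ - spr n R) * (ρ + spr n R + 2 * R * Real.cos (Real.pi / n)) = 0 := by
    linear_combination h - h1
  rcases mul_eq_zero.1 h4 with h5 | h5
  · linarith
  · have : 0 ≤ R * Real.cos (Real.pi / n) := by positivity
    linarith

lemma sp_dist (n : ℕ) (R r φ : ℝ) (k : Fin n) : spD (spQ r φ) (Bpt n R k) =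
    r ^ 2 + R ^ 2 + 2 * r * R * Real.cos (φ - 2 * (k.val : ℝ) * Real.pi / n) := by
  simp only [spD, spQ, Bpt, Real.cos_sub]
  set θ := 2 * (k.val : ℝ) * Real.pi / n
  linear_combination r ^ 2 * Real.sin_sq_add_cos_sq φ + R ^ 2 * Real.sin_sq_add_cos_sq θ

lemma sp_cosdiff (n : ℕ) (i : ℤ) : Real.cos (Real.pi / n) - Real.cos ((2 * i + 1) * Real.pi / n) =
    2 * (Real.sin ((i + 1) * Real.pi / n) * Real.sin (i * Real.pi / n)) := by
  rw [Real.cos_sub_cos]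
  have e1 : (Real.pi / n + (2 * i + 1) * Real.pi / n) / 2 = (i + 1) * Real.pi / n := by ring
  have e2 : (Real.pi / n - (2 * i + 1) * Real.pi / n) / 2 = -(i * Real.pi / n) := by ring
  rw [e1, e2, Real.sin_neg]
  ring

lemma sp_sin_pos (n : ℕ) (i : ℤ) (h0 : 0 < i) (h1 : i < n) : 0 < Real.sin (i * Real.pi / n) := by
  have h0' : (0 : ℝ) < i := by exact_mod_cast h0
  have h1' : (i : ℝ) < n := by exact_mod_cast h1
  have hp := Real.pi_pos
  have hn : (0 : ℝ) < n := by linarith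
  apply Real.sin_pos_of_pos_of_lt_pi
  · positivity
  · rw [div_lt_iff₀ hn]; nlinarith

lemma sp_sin_neg (n : ℕ) (i : ℤ) (h0 : i < 0) (h1 : -n < i) : Real.sin (i * Real.pi / n) < 0 := by
  have := sp_sin_pos n (-i) (by omega) (by omega)
  push_cast at this
  rw [neg_mul, neg_div, Real.sin_neg] at this
  linarith

/-- adjacency -/
def spAdj (n : ℕ) (m k : Fin n) : Prop := k = m ∨ k.val = m.val + 1 ∨ (m.val + 1 = n ∧ k.val = 0)

lemma sp_cos_eq (n : ℕ) (m k : Fin n) (h : spAdj n m k) :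
    Real.cos ((2 * (m.val : ℝ) + 1) * Real.pi / n - 2 * (k.val : ℝ) * Real.pi / n) =
      Real.cos (Real.pi / n) := by
  have hn : (n : ℝ) ≠ 0 := by
    have := m.pos
    positivity
  have e : (2 * (m.val : ℝ) + 1) * Real.pi / n - 2 * (k.val : ℝ) * Real.pi / n =
    (2 * (((m.val : ℤ) - (k.val : ℤ) : ℤ) : ℝ) + 1) * Real.pi / n := by push_cast; ring
  rw [e]
  have := sp_cosdiff n ((m.val : ℤ) - (k.val : ℤ))
  have hz : Real.sin (((((m.val : ℤ) - (k.val : ℤ) : ℤ) : ℝ) + 1) * Real.pi / n) *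
    Real.sin ((((m.val : ℤ) - (k.val : ℤ) : ℤ) : ℝ) * Real.pi / n) = 0 := by
    rcases h with rfl | h | ⟨h, h'⟩
    · simp
    · rw [h]; simp
    · have : (((m.val : ℤ) - (k.val : ℤ) : ℤ) : ℝ) + 1 = n := by
        rw [h']; push_cast; rw [sub_zero]; exact_mod_cast h
      rw [this, mul_div_assoc, mul_div_cancel₀ _ hn]; simp
  rw [hz] at this
  linarith

lemma sp_cos_lt (n : ℕ) (m k : Fin n) (h : ¬ spAdj n m k) :
    Real.cos ((2 * (m.val : ℝ) + 1) * Real.pi / n - 2 * (k.val : ℝ) * Real.pi / n) <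
      Real.cos (Real.pi / n) := by
  have e : (2 * (m.val : ℝ) + 1) * Real.pi / n - 2 * (k.val : ℝ) * Real.pi / n =
    (2 * (((m.val : ℤ) - (k.val : ℤ) : ℤ) : ℝ) + 1) * Real.pi / n := by push_cast; ring
  rw [e]
  have := sp_cosdiff n ((m.val : ℤ) - (k.val : ℤ))
  have hm := m.isLt
  have hk := k.isLt
  unfold spAdj at h
  rw [Fin.ext_iff] at h
  have hz : 0 < Real.sin (((((m.val : ℤ) - (k.val : ℤ) : ℤ) : ℝ) + 1) * Real.pi / n) *
    Real.sin ((((m.val : ℤ) - (k.val : ℤ) : ℤ) : ℝ) * Real.pi / n) := by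
    have e2 : ((((m.val : ℤ) - (k.val : ℤ) : ℤ) : ℝ) + 1) =
      (((m.val : ℤ) - (k.val : ℤ) + 1 : ℤ) : ℝ) := by push_cast; ring
    rw [e2]
    rcases lt_or_ge k.val m.val with h1 | h1
    · exact mul_pos (sp_sin_pos n _ (by omega) (by omega)) (sp_sin_pos n _ (by omega) (by omega))
    · exact mul_pos_of_neg_of_neg (sp_sin_neg n _ (by omega) (by omega))
        (sp_sin_neg n _ (by omega) (by omega))
  linarith

lemma sp_PD_eq (n : ℕ) (R : ℝ) (hR0 : 0 < R) (hR2 : R < 2) (m k : Fin n) (h : spAdj n m k) :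
    spD (spP n R m) (Bpt n R k) = 4 := by
  rw [spP, sp_dist, sp_cos_eq n m k h, sp_r_eq n R hR0 hR2]

lemma sp_PD_lt (n : ℕ) (R : ℝ) (hR0 : 0 < R) (hR2 : R < 2) (m k : Fin n) (h : ¬ spAdj n m k) :
    spD (spP n R m) (Bpt n R k) < 4 := by
  rw [spP, sp_dist]
  have h1 := sp_cos_lt n m k h
  have h2 := sp_r_eq n R hR0 hR2
  have h3 : 0 < spr n R * R := mul_pos (sp_r_pos n R hR0 hR2) hR0
  nlinarith

lemma sp_PD_pos (n : ℕ) (R : ℝ) (hR0 : 0 < R) (hR2 : R < 2)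
    (hRne : R ≠ Rcrit n) (m k : Fin n) : 0 < spD (spP n R m) (Bpt n R k) := by
  have hn : (n : ℝ) ≠ 0 := by
    have := m.pos
    positivity
  have h2 := sp_r_eq n R hR0 hR2
  have h3 : 0 < spr n R * R := mul_pos (sp_r_pos n R hR0 hR2) hR0
  by_contra hcon
  have h0 : spD (spP n R m) (Bpt n R k) = 0 :=
    le_antisymm (not_lt.1 hcon) (by unfold spD; positivity)
  rw [spP, sp_dist] at h0
  set x := (2 * (m.val : ℝ) + 1) * Real.pi / n - 2 * (k.val : ℝ) * Real.pi / n with hx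
  have h4 := Real.neg_one_le_cos x
  have h5 : (spr n R - R) ^ 2 + 2 * (spr n R * R) * (1 + Real.cos x) = 0 := by
    linear_combination h0
  have h6 : 0 ≤ 2 * (spr n R * R) * (1 + Real.cos x) := by
    apply mul_nonneg (by positivity); linarith
  have h7 : spr n R = R := by
    have : spr n R - R = 0 := by
      apply pow_eq_zero_iff (two_ne_zero) |>.1
      nlinarith [sq_nonneg (spr n R - R)]
    linarith
  have h8 : Real.cos x = -1 := by
    have : 2 * (spr n R * R) * (1 + Real.cos x) = 0 := by nlinarith [sq_nonneg (spr n R - R)]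
    rcases mul_eq_zero.1 this with h | h
    · linarith
    · linarith
  rw [Real.cos_eq_neg_one_iff] at h8
  obtain ⟨t, ht⟩ := h8
  have hp := Real.pi_pos
  have h9 : (n : ℝ) * (1 + 2 * t) = 2 * (m.val : ℝ) + 1 - 2 * k.val := by
    rw [hx] at ht
    field_simp at ht
    linarith
  have h10 : (n : ℤ) * (1 + 2 * t) = 2 * (m.val : ℤ) + 1 - 2 * k.val := by exact_mod_cast h9
  have hodd : Odd n := by
    by_contra hne
    rw [Nat.not_odd_iff_even] at hne
    obtain ⟨a, ha⟩ := hne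
    have : (n : ℤ) = 2 * a := by omega
    rw [this, mul_assoc] at h10
    omega
  apply hRne
  unfold Rcrit dmax
  rw [if_neg (Nat.not_even_iff_odd.2 hodd)]
  obtain ⟨a, ha⟩ := hodd
  have hh : n / 2 = a := by omega
  have hna : (n : ℝ) = 2 * a + 1 := by rw [ha]; push_cast; ring
  have hang : 2 * ((n / 2 : ℕ) : ℝ) * Real.pi / (n : ℝ) = Real.pi - Real.pi / n := by
    rw [hh]
    field_simp
    rw [hna]; ring
  rw [hang, Real.cos_pi_sub]
  rw [h7] at h2
  have hsq : 2 - 2 * -Real.cos (Real.pi / n) = (2 / R) ^ 2 := by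
    field_simp
    linarith
  rw [hsq, Real.sqrt_sq (by positivity)]
  field_simp

lemma sp_int (n : ℕ) (hn : (n : ℝ) ≠ 0) (j k : Fin n) (t : ℤ)
    (h : 2 * (j.val : ℝ) * Real.pi / n - 2 * (k.val : ℝ) * Real.pi / n = t * (2 * Real.pi)) :
    j = k := by
  have hp := Real.pi_pos
  have h9 : (j.val : ℝ) - k.val = n * t := by
    field_simp at h
    linarith
  have h10 : (j.val : ℤ) - k.val = n * t := by exact_mod_cast h9
  have hj := j.isLt
  have hk := k.isLt
  have : (j.val : ℤ) - k.val = 0 := by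
    apply Int.eq_zero_of_abs_lt_dvd (m := n) ⟨t, h10⟩
    rw [abs_lt]; constructor <;> omega
  ext; omega

lemma sp_P_inj (n : ℕ) (R : ℝ) (hR0 : 0 < R) (hR2 : R < 2) : Function.Injective (spP n R) := by
  intro m m' h
  have hn : (n : ℝ) ≠ 0 := by
    have := m.pos
    positivity
  have hr := sp_r_pos n R hR0 hR2
  have e1 := congrArg Prod.fst h
  have e2 := congrArg Prod.snd h
  simp only [spP, spQ, neg_inj] at e1 e2
  have e1 := mul_left_cancel₀ hr.ne' e1
  have e2 := mul_left_cancel₀ hr.ne' e2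
  have : Real.cos ((2 * (m.val : ℝ) + 1) * Real.pi / n - (2 * (m'.val : ℝ) + 1) * Real.pi / n)
      = 1 := by
    rw [Real.cos_sub, e1, e2]
    nlinarith [Real.sin_sq_add_cos_sq ((2 * (m'.val : ℝ) + 1) * Real.pi / n)]
  rw [Real.cos_eq_one_iff] at this
  obtain ⟨t, ht⟩ := this
  apply sp_int n hn m m' t
  rw [ht]; ring

lemma sp_cos_shift (n : ℕ) (hn : (n : ℝ) ≠ 0) (u : ℤ) (a : ℝ) :
    spQ a ((2 * (u : ℝ) + 1) * Real.pi / n) =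
    spQ a ((2 * ((u % n : ℤ) : ℝ) + 1) * Real.pi / n) := by
  have h : (2 * (u : ℝ) + 1) * Real.pi / n =
    (2 * ((u % n : ℤ) : ℝ) + 1) * Real.pi / n + ((u / n : ℤ) : ℝ) * (2 * Real.pi) := by
    have h1 : (u : ℝ) = ((u % n : ℤ) : ℝ) + n * ((u / n : ℤ) : ℝ) := by
      exact_mod_cast (Int.emod_add_mul_ediv u n).symm
    conv_lhs => rw [h1]
    field_simp
    ring
  rw [h]
  simp only [spQ, Real.cos_add_int_mul_two_pi, Real.sin_add_int_mul_two_pi]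

lemma sp_polar (C : ℝ × ℝ) : ∃ r φ : ℝ, 0 ≤ r ∧ C = spQ r φ := by
  let z : ℂ := ⟨-C.1, -C.2⟩
  refine ⟨‖z‖, z.arg, norm_nonneg _, ?_⟩
  have h1 := Complex.norm_mul_cos_arg z
  have h2 := Complex.norm_mul_sin_arg z
  unfold spQ
  rw [h1, h2]
  simp [z]

lemma sp_vertex (n : ℕ) (hn2 : 2 ≤ n) (R : ℝ) (hR0 : 0 < R) (hR2 : R < 2) (C : ℝ × ℝ)
    (hC : ∀ k : Fin n, spD C (Bpt n R k) ≤ 4) (j k : Fin n) (hjk : j ≠ k)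
    (hj : spD C (Bpt n R j) = 4) (hk : spD C (Bpt n R k) = 4) : ∃ m : Fin n, C = spP n R m := by
  have hn : (n : ℝ) ≠ 0 := by positivity
  have hp := Real.pi_pos
  obtain ⟨ρ, φ, hρ, rfl⟩ := sp_polar C
  simp only [sp_dist] at hC hj hk
  have hρ' : 0 < ρ := by
    rcases hρ.lt_or_eq with h | h
    · exact h
    · rw [← h] at hj; nlinarith
  have hpos : 0 < 2 * ρ * R := by positivity
  have hmax : ∀ i : Fin n, Real.cos (φ - 2 * (i.val : ℝ) * Real.pi / n) ≤
      Real.cos (φ - 2 * (j.val : ℝ) * Real.pi / n) := by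
    intro i
    have := hC i
    refine le_of_mul_le_mul_left ?_ hpos
    linarith
  have heq : Real.cos (φ - 2 * (j.val : ℝ) * Real.pi / n) =
      Real.cos (φ - 2 * (k.val : ℝ) * Real.pi / n) := by
    apply mul_left_cancel₀ hpos.ne'
    linarith
  have hno1 : Real.cos (φ - 2 * (j.val : ℝ) * Real.pi / n) ≠ 1 := by
    intro h
    have h' := h
    rw [heq] at h'
    rw [Real.cos_eq_one_iff] at h h'
    obtain ⟨a, ha⟩ := h
    obtain ⟨b, hb⟩ := h'
    apply hjk
    apply sp_int n hn j k (b - a)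
    push_cast
    linarith
  have hs : ∃ s : ℤ, φ = s * Real.pi / n := by
    rw [Real.cos_eq_cos_iff] at heq
    obtain ⟨t, h | h⟩ := heq
    · exfalso
      apply hjk
      apply sp_int n hn j k t
      linarith
    · refine ⟨j.val + k.val + n * t, ?_⟩
      push_cast
      field_simp at h ⊢
      linarith
  obtain ⟨s, hs⟩ := hs
  obtain ⟨u, hu | hu⟩ := Int.even_or_odd' s
  · exfalso
    apply hno1
    apply le_antisymm (Real.cos_le_one _)
    have hnz : (n : ℤ) ≠ 0 := by omega
    have hu0 := Int.emod_nonneg u hnz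
    have hu1 := Int.emod_lt_of_pos u (show (0 : ℤ) < n by omega)
    obtain ⟨w, hw⟩ := Int.eq_ofNat_of_zero_le hu0
    have := hmax ⟨w, by omega⟩
    refine le_trans (le_of_eq ?_) this
    symm
    rw [Real.cos_eq_one_iff]
    refine ⟨u / n, ?_⟩
    have h1 : (u : ℝ) = w + n * ((u / n : ℤ) : ℝ) := by
      have := (Int.emod_add_mul_ediv u n).symm
      rw [hw] at this
      exact_mod_cast this
    rw [hs, hu]
    push_cast
    field_simp
    linarith
  · have hφ : φ = (2 * (u : ℝ) + 1) * Real.pi / n := by rw [hs, hu]; push_cast; ring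
    have hnz : (n : ℤ) ≠ 0 := by omega
    have hu0 := Int.emod_nonneg u hnz
    have hu1 := Int.emod_lt_of_pos u (show (0 : ℤ) < n by omega)
    obtain ⟨w, hw⟩ := Int.eq_ofNat_of_zero_le hu0
    have hQ := sp_cos_shift n hn u ρ
    rw [hw] at hQ
    have hwn : w < n := by omega
    refine ⟨⟨w, hwn⟩, ?_⟩
    rw [← hφ] at hQ
    simp only [Int.ofNat_eq_natCast, Int.cast_natCast] at hQ
    rw [hQ]
    -- radius
    have hd : ∀ i : Fin n, spD (spQ ρ φ) (Bpt n R i) = ρ ^ 2 + R ^ 2 + 2 * ρ * R *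
        Real.cos ((2 * (w : ℝ) + 1) * Real.pi / n - 2 * (i.val : ℝ) * Real.pi / n) := by
      intro i; rw [hQ, sp_dist]
    have hC' : ∀ i : Fin n, spD (spQ ρ φ) (Bpt n R i) ≤ 4 := by
      intro i; rw [sp_dist]; exact hC i
    have hj' : spD (spQ ρ φ) (Bpt n R j) = 4 := by rw [sp_dist]; exact hj
    have h1 := hC' ⟨w, hwn⟩
    rw [hd, sp_cos_eq n ⟨w, hwn⟩ ⟨w, hwn⟩ (Or.inl rfl)] at h1
    rw [hd] at hj'
    have h2 : Real.cos ((2 * (w : ℝ) + 1) * Real.pi / n - 2 * (j.val : ℝ) * Real.pi / n) ≤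
        Real.cos (Real.pi / n) := by
      by_cases h : spAdj n ⟨w, hwn⟩ j
      · exact (sp_cos_eq n ⟨w, hwn⟩ j h).le
      · exact (sp_cos_lt n ⟨w, hwn⟩ j h).le
    have h3 := mul_le_mul_of_nonneg_left h2 hpos.le
    have h4 := sp_r_uniq n hn2 R hR0 hR2 ρ hρ' (by linarith)
    rw [spP, ← h4]

/-- cyclic successor -/
def spSucc (n : ℕ) (m : Fin n) : Fin n :=
  if h : m.val + 1 < n then ⟨m.val + 1, h⟩ else ⟨0, m.pos⟩

lemma sp_adj_iff (n : ℕ) (m k : Fin n) : spAdj n m k ↔ k = m ∨ k = spSucc n m := by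
  unfold spAdj spSucc
  have hm := m.isLt
  have hk := k.isLt
  split_ifs with h <;> simp only [Fin.ext_iff] <;> omega

lemma sp_succ_ne (n : ℕ) (hn : 2 ≤ n) (m : Fin n) : m ≠ spSucc n m := by
  unfold spSucc
  have hm := m.isLt
  split_ifs with h <;> simp only [ne_eq, Fin.ext_iff] <;> omega

noncomputable def spF (n : ℕ) (R : ℝ) (m : Fin n) : Finset ((ℝ × ℝ) × (Fin n → ℝ × ℝ)) :=
  {spP n R m} ×ˢ Fintype.piFinset (fun k => spA (spP n R m) (Bpt n R k))

lemma sp_cardF (n : ℕ) (hn : 2 ≤ n) (R : ℝ) (hR0 : 0 < R) (hR2 : R < 2)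
    (hRne : R ≠ Rcrit n) (m : Fin n) : (spF n R m).card = 2 ^ (n - 2) := by
  classical
  unfold spF
  rw [Finset.card_product, Finset.card_singleton, one_mul, Fintype.card_piFinset]
  have h : ∀ k ∈ (Finset.univ : Finset (Fin n)), (spA (spP n R m) (Bpt n R k)).card =
      if k ∈ ({m, spSucc n m} : Finset (Fin n)) then 1 else 2 := by
    intro k _
    have hiff : k ∈ ({m, spSucc n m} : Finset (Fin n)) ↔ spAdj n m k := by
      rw [sp_adj_iff]; simp
    split_ifs with hk
    · exact sp_cardA1 (sp_PD_eq n R hR0 hR2 m k (hiff.1 hk))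
    · exact sp_cardA2 (sp_PD_pos n R hR0 hR2 hRne m k)
        (sp_PD_lt n R hR0 hR2 m k (fun h => hk (hiff.2 h)))
  rw [Finset.prod_congr rfl h, Finset.prod_ite]
  simp only [Finset.prod_const_one, one_mul, Finset.prod_const]
  congr 1
  have : (Finset.univ.filter (fun k => k ∉ ({m, spSucc n m} : Finset (Fin n)))) =
    ({m, spSucc n m} : Finset (Fin n))ᶜ := by ext; simp
  rw [this, Finset.card_compl, Finset.card_pair (sp_succ_ne n hn m), Fintype.card_fin]

/-- Suppose `0 < R < 2` and `R ≠ R_n`. The set of configurations in `M_n(R)` with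
at least two stretched-out arms is finite, with exactly `n·2^{n−2}` elements. -/
theorem stmt15 (n : ℕ) (hn : 2 ≤ n) (R : ℝ) (hR0 : 0 < R) (hR2 : R < 2)
    (hRne : R ≠ Rcrit n) :
    {x ∈ MSpace n R | ∃ j k : Fin n, j ≠ k ∧
        x.1 - x.2 j = x.2 j - Bpt n R j ∧
        x.1 - x.2 k = x.2 k - Bpt n R k}.Finite ∧
    {x ∈ MSpace n R | ∃ j k : Fin n, j ≠ k ∧
        x.1 - x.2 j = x.2 j - Bpt n R j ∧
        x.1 - x.2 k = x.2 k - Bpt n R k}.ncard = n * 2 ^ (n - 2) := by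
  classical
  have hle : ∀ m k : Fin n, spD (spP n R m) (Bpt n R k) ≤ 4 := by
    intro m k
    by_cases h : spAdj n m k
    · exact (sp_PD_eq n R hR0 hR2 m k h).le
    · exact (sp_PD_lt n R hR0 hR2 m k h).le
  have hmem : ∀ (m : Fin n) x, x ∈ spF n R m ↔ x.1 = spP n R m ∧ x ∈ MSpace n R := by
    rintro m ⟨C, J⟩
    simp only [spF, Finset.mem_product, Finset.mem_singleton, Fintype.mem_piFinset, MSpace,
      Set.mem_setOf_eq]
    apply and_congr_right
    rintro rfl
    exact forall_congr' fun k => sp_memA (sp_PD_pos n R hR0 hR2 hRne m k) (hle m k)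
  have hset : {x ∈ MSpace n R | ∃ j k : Fin n, j ≠ k ∧
        x.1 - x.2 j = x.2 j - Bpt n R j ∧
        x.1 - x.2 k = x.2 k - Bpt n R k} =
      ((Finset.univ.biUnion (spF n R) : Finset ((ℝ × ℝ) × (Fin n → ℝ × ℝ))) : Set _) := by
    ext x
    simp only [Set.mem_setOf_eq, Finset.mem_coe, Finset.mem_biUnion, Finset.mem_univ, true_and,
      hmem]
    constructor
    · rintro ⟨hM, j, k, hjk, hj, hk⟩
      have hM' : ∀ k : Fin n, enorm2 (x.1 - x.2 k) = 1 ∧ enorm2 (x.2 k - Bpt n R k) = 1 := hM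
      obtain ⟨m, hm⟩ := sp_vertex n hn R hR0 hR2 x.1 (fun i => sp_le (hM' i).1 (hM' i).2) j k hjk
        (sp_str (hM' j).1 hj) (sp_str (hM' k).1 hk)
      exact ⟨m, hm, hM⟩
    · rintro ⟨m, hm, hM⟩
      have hM' : ∀ k : Fin n, enorm2 (x.1 - x.2 k) = 1 ∧ enorm2 (x.2 k - Bpt n R k) = 1 := hM
      refine ⟨hM, m, spSucc n m, sp_succ_ne n hn m, ?_, ?_⟩
      · apply sp_str' (hM' _).1 (hM' _).2
        rw [hm]
        exact sp_PD_eq n R hR0 hR2 m _ ((sp_adj_iff n _ _).2 (Or.inl rfl))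
      · apply sp_str' (hM' _).1 (hM' _).2
        rw [hm]
        exact sp_PD_eq n R hR0 hR2 m _ ((sp_adj_iff n _ _).2 (Or.inr rfl))
  rw [hset]
  refine ⟨Finset.finite_toSet _, ?_⟩
  rw [Set.ncard_coe_finset, Finset.card_biUnion]
  · rw [Finset.sum_congr rfl (fun m _ => sp_cardF n hn R hR0 hR2 hRne m)]
    simp
  · intro m _ m' _ hne
    rw [Function.onFun, Finset.disjoint_left]
    intro x hx hx'
    exact hne (sp_P_inj n R hR0 hR2 (((hmem m x).1 hx).1.symm.trans ((hmem m' x).1 hx').1))
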